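/- For every natural number n with n ∈ {4, 5, 6} or n > 9, there exists a very triangular number m satisfying t_n < m < t_{2n}. -/

import Mathlib

/-- The n-th triangular number. -/
def triangular (n : ℕ) : ℕ := n * (n + 1) / 2

/-- A natural number is triangular if it is `triangular n` for some `n`. -/
def IsTriangular (m : ℕ) : Prop := ∃ n : ℕ, triangular n = m

/-- The number of 1s in the binary representation of `m` (binary digit sum). -/
def binOnes (m : ℕ) : ℕ := (Nat.digits 2 m).sum

/-- A number is very triangular if it is triangular and its binary digit sum is triangular. -/
def IsVeryTriangular (m : ℕ) : Prop := IsTriangular m ∧ IsTriangular (binOnes m)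

theorem binOnes_two_mul (n : ℕ) : binOnes (2 * n) = binOnes n := by
  rcases Nat.eq_zero_or_pos n with rfl | hn
  · rfl
  · simp [binOnes, Nat.digits_def' (b := 2) (n := 2 * n) (by norm_num) (by omega)]

theorem binOnes_two_mul_add_one (n : ℕ) : binOnes (2 * n + 1) = binOnes n + 1 := by
  have h : (2 * n + 1) / 2 = n := by omega
  rw [binOnes, Nat.digits_def' (by norm_num) (by omega), h, List.sum_cons, binOnes]
  omega

theorem binOnes_two_pow_mul (j n : ℕ) : binOnes (2 ^ j * n) = binOnes n := by
  induction j with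
  | zero => simp
  | succ j ih => rw [pow_succ', mul_assoc, binOnes_two_mul, ih]

theorem two_mul_triangular (n : ℕ) : 2 * triangular n = n * (n + 1) :=
  Nat.mul_div_cancel' (Nat.even_mul_succ_self n).two_dvd

theorem triangular_strictMono : StrictMono triangular := by
  refine strictMono_nat_of_lt_succ fun n => ?_
  have h := two_mul_triangular n
  have h' := two_mul_triangular (n + 1)
  nlinarith

theorem binOnes_triangular_two_pow_add_three (c : ℕ) :
    binOnes (triangular (2 ^ (c + 4) + 3)) = 6 := by
  have ht : triangular (2 ^ (c + 4) + 3) =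
      2 * (2 * (2 * (2 ^ c * (2 * (2 * (2 * (2 ^ (c + 1) * 1) + 1) + 1) + 1)) + 1) + 1) := by
    have h := two_mul_triangular (2 ^ (c + 4) + 3)
    apply Nat.eq_of_mul_eq_mul_left (show 0 < 2 by norm_num)
    rw [h]
    ring
  rw [ht]
  simp only [binOnes_two_mul, binOnes_two_mul_add_one, binOnes_two_pow_mul]
  simp [binOnes]

theorem stmt14 (n : ℕ) (hn : n ∈ ({4, 5, 6} : Set ℕ) ∨ n > 9) :
    ∃ m : ℕ, IsVeryTriangular m ∧ triangular n < m ∧ m < triangular (2 * n) := by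
  suffices h : ∃ k, IsTriangular (binOnes (triangular k)) ∧ n < k ∧ k < 2 * n by
    obtain ⟨k, hk, h₁, h₂⟩ := h
    exact ⟨triangular k, ⟨⟨k, rfl⟩, hk⟩, triangular_strictMono h₁, triangular_strictMono h₂⟩
  have family (c : ℕ) : IsTriangular (binOnes (triangular (2 ^ (c + 4) + 3))) :=
    ⟨3, by rw [binOnes_triangular_two_pow_add_three]; rfl⟩
  rcases hn with hn | hn
  · simp only [Set.mem_insert_iff, Set.mem_singleton_iff] at hn
    rcases hn with rfl | rfl | rfl
    · exact ⟨7, ⟨2, by norm_num [binOnes, triangular]⟩, by norm_num, by norm_num⟩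
    · exact ⟨7, ⟨2, by norm_num [binOnes, triangular]⟩, by norm_num, by norm_num⟩
    · exact ⟨7, ⟨2, by norm_num [binOnes, triangular]⟩, by norm_num, by norm_num⟩
  · rcases Nat.lt_or_ge n 19 with h | h
    · exact ⟨19, family 0, h, by omega⟩
    · have h₁ : 2 ^ Nat.log 2 (n - 3) ≤ n - 3 := Nat.pow_log_le_self 2 (by omega)
      have h₂ : n - 3 < 2 ^ (Nat.log 2 (n - 3) + 1) := Nat.lt_pow_succ_log_self (by norm_num) _
      have h₃ : 4 ≤ Nat.log 2 (n - 3) := Nat.le_log_of_pow_le (by norm_num) (by omega)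
      obtain ⟨c, hc⟩ := Nat.exists_eq_add_of_le' h₃
      rw [hc] at h₁ h₂
      refine ⟨2 ^ (c + 1 + 4) + 3, family (c + 1), ?_, ?_⟩
      · rw [show c + 1 + 4 = c + 4 + 1 by ring]
        omega
      · rw [show c + 1 + 4 = c + 4 + 1 by ring, pow_succ]
        omega
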